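/- arXiv:2506.13524 — 4 statements merged into one kernel-verified Lean document; each statement's English description precedes it below -/
import Mathlib

section
/- Let T be a consistent first-order theory and let ρ be a map from sentences to sentences for which diagonal fixed points exist, i.e., there are sentences φ₀ and φ₁ with T ⊢ φ₀ ↔ ρ(φ₀) and T ⊢ φ₁ ↔ ¬ρ(φ₁) (as the diagonal lemma provides for any consistent theory extending the Tarski–Mostowski–Robinson theory R). Then ρ cannot satisfy both Independence and Extensionality over T; that is, there is no extensional Rosser formula over T. -/
open FirstOrder FirstOrder.Language

/-- `T + φ` is the theory `T ∪ {φ}`. A theory is consistent if it does not prove `⊥`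
(by completeness, provability is semantic consequence `⊨ᵇ`). -/
def TheoryConsistent {L : Language} (T : L.Theory) : Prop :=
  ¬ T ⊨ᵇ (⊥ : L.Sentence)

/-- Independence of a map `ρ` from sentences to sentences over `T`. -/
def IndependentMap {L : Language} (T : L.Theory) (ρ : L.Sentence → L.Sentence) : Prop :=
  ∀ φ : L.Sentence, TheoryConsistent (T ∪ {φ}) →
    TheoryConsistent (T ∪ {φ} ∪ {ρ φ}) ∧ TheoryConsistent (T ∪ {φ} ∪ {∼(ρ φ)})

/-- Extensionality of a map `ρ` over `T`. -/
def ExtensionalMap {L : Language} (T : L.Theory) (ρ : L.Sentence → L.Sentence) : Prop :=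
  ∀ φ ψ : L.Sentence, T ⊨ᵇ (φ ⇔ ψ) → T ⊨ᵇ (ρ φ ⇔ ρ ψ)

/-- Models of `T` in the universe used by semantic consequence. -/
abbrev SmallModel.{u, v} {L : FirstOrder.Language.{u, v}} (T : L.Theory) :=
  Theory.ModelType.{u, v, max u v} T

/-- Consistency is the existence of a model. -/
theorem theoryConsistent_of_model.{u, v} {L : FirstOrder.Language.{u, v}} {T : L.Theory}
    (h : TheoryConsistent T) : ∃ M : SmallModel T, True := by
  by_contra hM
  apply h
  rw [Theory.models_sentence_iff]
  intro M
  exact absurd ⟨M, trivial⟩ hM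

/-- If every model of `T` falsifies `φ ∧ ψ`, then `T + φ + ψ` is inconsistent. -/
theorem not_theoryConsistent_pair.{u, v} {L : FirstOrder.Language.{u, v}} {T : L.Theory} {φ ψ : L.Sentence}
    (h : ∀ M : SmallModel T, M ⊨ φ → ¬ M ⊨ ψ) :
    ¬ TheoryConsistent (T ∪ {φ} ∪ {ψ}) := by
  intro hc
  obtain ⟨M, -⟩ := theoryConsistent_of_model hc
  have hM := M.is_model
  have hT : M ⊨ T := hM.mono (by intro x hx; exact Or.inl (Or.inl hx))
  have hφ : M ⊨ φ := hM.realize_of_mem φ (Or.inl (Or.inr rfl))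
  have hψ : M ⊨ ψ := hM.realize_of_mem ψ (Or.inr rfl)
  exact h (Theory.ModelType.of T M) hφ hψ

/-- If `T + φ` is inconsistent, every model of `T` falsifies `φ`. -/
theorem not_realize_of_not_consistent.{u, v} {L : FirstOrder.Language.{u, v}} {T : L.Theory} {φ : L.Sentence}
    (h : ¬ TheoryConsistent (T ∪ {φ})) (M : SmallModel T) :
    ¬ M ⊨ φ := by
  intro hφ
  apply h
  intro hb
  rw [Theory.models_sentence_iff] at hb
  have : M ⊨ T ∪ {φ} := by
    rw [Theory.model_iff]
    rintro x (hx | rfl)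
    · exact Theory.realize_sentence_of_mem T hx
    · exact hφ
  exact hb (Theory.ModelType.of (T ∪ {φ}) M)

/-- There is no extensional Rosser formula: if `T` is consistent and `ρ` admits the
diagonal fixed points `φ₀`, `φ₁`, then `ρ` cannot be both independent and extensional. -/
theorem no_extensional_rosser {L : Language} (T : L.Theory)
    (hT : TheoryConsistent T) (ρ : L.Sentence → L.Sentence)
    (φ₀ φ₁ : L.Sentence)
    (h₀ : T ⊨ᵇ (φ₀ ⇔ ρ φ₀)) (h₁ : T ⊨ᵇ (φ₁ ⇔ ∼(ρ φ₁))) :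
    ¬ (IndependentMap T ρ ∧ ExtensionalMap T ρ) := by
  rintro ⟨hI, hE⟩
  rw [Theory.models_sentence_iff] at h₀ h₁
  have key₀ : ∀ M : SmallModel T, M ⊨ φ₀ ↔ M ⊨ ρ φ₀ := by
    intro M
    exact BoundedFormula.realize_iff.1 (h₀ M)
  have key₁ : ∀ M : SmallModel T, M ⊨ φ₁ ↔ ¬ M ⊨ ρ φ₁ := by
    intro M
    exact (BoundedFormula.realize_iff.1 (h₁ M)).trans BoundedFormula.realize_not
  have n₀ := not_realize_of_not_consistent (T := T) (φ := φ₀) (fun hc =>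
    not_theoryConsistent_pair
      (fun M h h' => (Sentence.realize_not M).1 h' ((key₀ M).1 h)) (hI φ₀ hc).2)
  have n₁ := not_realize_of_not_consistent (T := T) (φ := φ₁) (fun hc =>
    not_theoryConsistent_pair (fun M h h' => (key₁ M).1 h h') (hI φ₁ hc).1)
  have e := hE φ₀ φ₁ (by
    rw [Theory.models_sentence_iff]
    intro M
    exact BoundedFormula.realize_iff.2 (iff_of_false (n₀ M) (n₁ M)))
  rw [Theory.models_sentence_iff] at e
  obtain ⟨M, -⟩ := theoryConsistent_of_model hT
  have eM : M ⊨ ρ φ₀ ↔ M ⊨ ρ φ₁ := BoundedFormula.realize_iff.1 (e M)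
  exact n₁ M ((key₁ M).2 (fun h => n₀ M ((key₀ M).2 (eM.2 h))))
end

section
/- Let T be a theory, △ an operator on sentences, and Σ a set of sentences satisfying: (monotonicity) if T ⊢ α → β then T ⊢ △α → △β; (conjunction) T ⊢ (△α ∧ △β) → △(α ∧ β); (Σ-completeness) T ⊢ σ → △σ for every σ ∈ Σ; and (Feferman property) T ⊢ ¬△⊥. Let γ be a Gödel sentence for △, i.e., T ⊢ γ ↔ ¬△γ. Then for every sentence π such that some σ ∈ Σ satisfies T ⊢ σ ↔ ¬π: if T ⊢ γ → π then T ⊢ π, and if T ⊢ ¬γ → π then T ⊢ π. (Arithmetical reading: for any c.e. extension U of PA and Feferman-style provability △ for any enumeration of U, both a Gödel sentence γ for △ and its negation ¬γ are Π⁰₁-conservative over U, taking Σ to be the Σ⁰₁-sentences and π to range over Π⁰₁-sentences.) -/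
open FirstOrder FirstOrder.Language

/-- Gödel sentences for a Feferman-style provability operator, and the negations of such
sentences, are conservative with respect to sentences whose negation lies in `Σ`. -/
theorem godel_sentence_feferman_conservative {L : Language} (T : L.Theory)
    (tri : L.Sentence → L.Sentence) (S : Set L.Sentence)
    (mono : ∀ α β : L.Sentence, T ⊨ᵇ (α ⟹ β) → T ⊨ᵇ (tri α ⟹ tri β))
    (conj : ∀ α β : L.Sentence, T ⊨ᵇ ((tri α ⊓ tri β) ⟹ tri (α ⊓ β)))
    (sigmaComplete : ∀ σ ∈ S, T ⊨ᵇ (σ ⟹ tri σ))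
    (feferman : T ⊨ᵇ (∼(tri ⊥)))
    (γ : L.Sentence) (hγ : T ⊨ᵇ (γ ⇔ ∼(tri γ))) :
    ∀ π : L.Sentence, (∃ σ ∈ S, T ⊨ᵇ (σ ⇔ ∼π)) →
      (T ⊨ᵇ (γ ⟹ π) → T ⊨ᵇ π) ∧ (T ⊨ᵇ (∼γ ⟹ π) → T ⊨ᵇ π) := by
  rintro π ⟨σ, hσS, hσ⟩
  have hc := sigmaComplete σ hσS
  constructor
  · intro h
    have hbot : T ⊨ᵇ ((σ ⊓ γ) ⟹ (⊥ : L.Sentence)) := by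
      intro M v xs
      have h1 := hσ M v xs
      have h2 := h M v xs
      simp only [BoundedFormula.realize_imp, BoundedFormula.realize_iff,
        BoundedFormula.realize_not, BoundedFormula.realize_inf,
        BoundedFormula.realize_bot] at h1 h2 ⊢
      tauto
    have hm := mono _ _ hbot
    have hj := conj σ γ
    intro M v xs
    have h1 := hσ M v xs
    have h2 := h M v xs
    have h3 := hm M v xs
    have h4 := hj M v xs
    have h5 := hc M v xs
    have h6 := feferman M v xs
    have h7 := hγ M v xs
    simp only [BoundedFormula.realize_imp, BoundedFormula.realize_iff,
      BoundedFormula.realize_not, BoundedFormula.realize_inf] at h1 h2 h3 h4 h5 h6 h7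
    tauto
  · intro h
    have himp : T ⊨ᵇ (σ ⟹ γ) := by
      intro M v xs
      have h1 := hσ M v xs
      have h2 := h M v xs
      simp only [BoundedFormula.realize_imp, BoundedFormula.realize_iff,
        BoundedFormula.realize_not] at h1 h2 ⊢
      tauto
    have hm := mono _ _ himp
    intro M v xs
    have h1 := hσ M v xs
    have h2 := h M v xs
    have h3 := hm M v xs
    have h5 := hc M v xs
    have h7 := hγ M v xs
    simp only [BoundedFormula.realize_imp, BoundedFormula.realize_iff,
      BoundedFormula.realize_not] at h1 h2 h3 h5 h7
    tauto
end

section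
/- Let T be a theory, □ an operator on sentences, and Σ a set of sentences satisfying: (necessitation) if T ⊢ α then T ⊢ □α; (K-distribution) T ⊢ □(α → β) → (□α → □β); (Löb's rule) if T ⊢ □α → α then T ⊢ α; and (Σ-completeness) T ⊢ σ → □σ for every σ ∈ Σ. Then for every sentence π such that some σ ∈ Σ satisfies T ⊢ σ ↔ ¬π: if T + □⊥ ⊢ π then T ⊢ π. (Arithmetical reading, the Kreisel–Feferman fact: for any extension U of Elementary Arithmetic EA whose axiom set is given by an elementary predicate α, the inconsistency statement □_α⊥ is Π⁰₁-conservative over U, taking Σ to be the Σ⁰₁-sentences and π to range over Π⁰₁-sentences.) -/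
open FirstOrder FirstOrder.Language

/-- Kreisel–Feferman: for a provability operator `□` satisfying necessitation,
K-distribution, Löb's rule and `Σ`-completeness, the inconsistency statement `□⊥` is
conservative over `T` with respect to sentences whose negation lies in `Σ`. -/
theorem inconsistency_conservative {L : Language} (T : L.Theory)
    (box : L.Sentence → L.Sentence) (S : Set L.Sentence)
    (nec : ∀ α : L.Sentence, T ⊨ᵇ α → T ⊨ᵇ box α)
    (kdist : ∀ α β : L.Sentence, T ⊨ᵇ (box (α ⟹ β) ⟹ (box α ⟹ box β)))
    (loeb : ∀ α : L.Sentence, T ⊨ᵇ (box α ⟹ α) → T ⊨ᵇ α)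
    (sigmaComplete : ∀ σ ∈ S, T ⊨ᵇ (σ ⟹ box σ)) :
    ∀ π : L.Sentence, (∃ σ ∈ S, T ⊨ᵇ (σ ⇔ ∼π)) →
      (T ∪ {box ⊥} ⊨ᵇ π → T ⊨ᵇ π) := by
  rintro π ⟨σ, hσ, hσπ⟩ hπ
  have key : ∀ (M : T.ModelType) (φ : L.Sentence), T ⊨ᵇ φ → M ⊨ φ :=
    fun M φ h => Theory.models_sentence_iff.1 h M
  have imp : ∀ (M : T.ModelType) (φ ψ : L.Sentence),
      M ⊨ (φ ⟹ ψ : L.Sentence) ↔ (M ⊨ φ → M ⊨ ψ) := by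
    intro M φ ψ
    simp [Sentence.Realize, Formula.Realize]
  have h1 : T ⊨ᵇ (π ⟹ (σ ⟹ ⊥) : L.Sentence) := by
    rw [Theory.models_sentence_iff]
    intro M
    have h := key M _ hσπ
    simp only [Sentence.Realize, Formula.Realize, BoundedFormula.realize_iff,
      BoundedFormula.realize_not, BoundedFormula.realize_imp,
      BoundedFormula.realize_bot] at h ⊢
    tauto
  have h2 := nec _ h1
  apply loeb
  rw [Theory.models_sentence_iff]
  intro M
  rw [imp]
  intro hb
  by_contra hn
  have hs : M ⊨ σ := by
    have h := key M _ hσπ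
    simp only [Sentence.Realize, Formula.Realize, BoundedFormula.realize_iff,
      BoundedFormula.realize_not] at h hn ⊢
    tauto
  have h3 := (imp M _ _).1 (key M _ (sigmaComplete σ hσ)) hs
  have h4 := (imp M _ _).1 ((imp M _ _).1 (key M _ (kdist _ _)) (key M _ h2)) hb
  have h5 := (imp M _ _).1 ((imp M _ _).1 (key M _ (kdist _ _)) h4) h3
  have hM : M ⊨ T ∪ {box ⊥} := by
    rw [Theory.model_iff]
    rintro φ (h | h)
    · exact Theory.realize_sentence_of_mem T h
    · rw [Set.mem_singleton_iff.1 h]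
      exact h5
  exact hn (Theory.models_sentence_iff.1 hπ (Theory.ModelType.of (T ∪ {box ⊥}) M))
end

section
/- Let U be a consistent theory and let φ ↦ ρ_φ be any map from sentences to sentences (of any complexity). Then the following two conditions cannot both hold: (Independence) for every sentence φ, if U + φ is consistent then U ⊬ φ → ρ_φ and U ⊬ φ → ¬ρ_φ; (Monotonicity) for all sentences φ, ψ, if U ⊢ φ → ψ then U ⊢ ρ_φ → ρ_ψ. In other words, independence and monotonicity cannot be combined. -/
open FirstOrder FirstOrder.Language

/-- Independence and monotonicity cannot be combined: for a consistent theory `U` and any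
map `φ ↦ ρ φ` on sentences, it is impossible that both
(Independence) whenever `U + φ` is consistent, `U ⊬ φ → ρ φ` and `U ⊬ φ → ¬ρ φ`, and
(Monotonicity) `U ⊢ φ → ψ` implies `U ⊢ ρ φ → ρ ψ`. -/
theorem no_independent_monotone {L : Language} (U : L.Theory)
    (hU : TheoryConsistent U) (ρ : L.Sentence → L.Sentence) :
    ¬ ((∀ φ : L.Sentence, TheoryConsistent (U ∪ {φ}) →
          ¬ U ⊨ᵇ (φ ⟹ ρ φ) ∧ ¬ U ⊨ᵇ (φ ⟹ ∼(ρ φ))) ∧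
       (∀ φ ψ : L.Sentence, U ⊨ᵇ (φ ⟹ ψ) → U ⊨ᵇ (ρ φ ⟹ ρ ψ))) := by
  rintro ⟨hI, hM⟩
  -- consistency of `U + χ` follows from `U ⊬ χ → ⊥`
  have cons : ∀ χ : L.Sentence, ¬ U ⊨ᵇ (∼χ) → TheoryConsistent (U ∪ {χ}) := by
    intro χ h hc
    apply h
    rw [Theory.models_sentence_iff] at hc ⊢
    intro M
    refine Sentence.realize_not M |>.2 fun hχ => ?_
    have : (M : Type _) ⊨ (U ∪ {χ}) := by
      rw [Theory.model_union_iff, Theory.model_singleton_iff]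
      exact ⟨M.is_model, hχ⟩
    have := hc (Theory.ModelType.of (U ∪ {χ}) M)
    exact this
  have h1 := (hI ⊤ (cons ⊤ fun h => hU <| by
    rw [Theory.models_sentence_iff] at h ⊢
    intro M
    have := h M
    simp [Sentence.Realize, Formula.Realize] at this)).1
  have h2 : ¬ U ⊨ᵇ (∼(∼(ρ ⊤))) := fun h => h1 <| by
    rw [Theory.models_sentence_iff] at h ⊢
    intro M
    have := h M
    simpa [Sentence.Realize, Formula.Realize] using this
  refine (hI _ (cons _ h2)).2 ?_
  have h3 := hM (∼(ρ ⊤)) ⊤ (by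
    rw [Theory.models_sentence_iff]
    intro M
    simp [Sentence.Realize, Formula.Realize])
  rw [Theory.models_sentence_iff] at h3 ⊢
  intro M
  have := h3 M
  simp only [Sentence.Realize, Formula.Realize, BoundedFormula.realize_imp,
    BoundedFormula.realize_not] at this ⊢
  exact fun a b => a (this b)
end
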